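/- arXiv:2505.10571 — 2 statements merged into one kernel-verified Lean document; each statement's English description precedes it below -/
import Mathlib

section
/- Let x be a list over a type α with x.length = 4, let a be any natural number, and let j satisfy 1 ≤ j ≤ 4. Set l = (x ++ x).rotate a and m = ((l.drop 3).take j) ++ (l.take 3) ++ ((l.drop 3).drop j). Then m.head? = m.getLast?. -/
theorem List.rotate_append_self {α : Type*} (x : List α) (n : ℕ) :
    (x ++ x).rotate n = x.rotate n ++ x.rotate n := by
  induction n generalizing x with
  | zero => simp
  | succ n ih =>
    cases x with
    | nil => simp
    | cons b t =>
      rw [List.cons_append, List.rotate_cons_succ, List.rotate_cons_succ, ← ih]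
      simp

theorem combined_boundary {α : Type*} (x : List α) (hx : x.length = 4)
    (a : ℕ) (j : ℕ) (hj1 : 1 ≤ j) (hj4 : j ≤ 4) :
    let l := (x ++ x).rotate a
    let m := ((l.drop 3).take j) ++ (l.take 3) ++ ((l.drop 3).drop j)
    m.head? = m.getLast? := by
  intro l m
  have hy : (x.rotate a).length = 4 := by rw [List.length_rotate, hx]
  obtain ⟨p, q, r, s, hpqrs⟩ := List.length_eq_four.mp hy
  have hl : l = [p, q, r, s, p, q, r, s] := by
    simp [l, List.rotate_append_self, hpqrs]
  simp only [m, hl]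
  interval_cases j <;> rfl
end

section
/- Define h : List α → List α by h l = (l.eraseIdx 1).rotate 1. Let c be a natural number with 1 ≤ c ≤ 3 and let l be a list over a type α with l.length = 7 - c. Then the elimination process applied after a rotation by 7 converges to the last element of l: for every v, l.getLast? = some v implies h^[6 - c] (l.rotate 7) = [v]. -/
def elimStep {α : Type*} (l : List α) : List α := (l.eraseIdx 1).rotate 1

theorem elimStep_cons_cons {α : Type*} (a b : α) (l : List α) :
    elimStep (a :: b :: l) = l ++ [a] := by
  simp [elimStep]

theorem convergence_lemma {α : Type*} (c : ℕ) (hc1 : 1 ≤ c) (hc3 : c ≤ 3)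
    (l : List α) (hl : l.length = 7 - c) (v : α) (hv : l.getLast? = some v) :
    elimStep^[6 - c] (l.rotate 7) = [v] := by
  obtain ⟨l, rfl⟩ := List.getLast?_eq_some_iff.mp hv
  interval_cases c
  · obtain ⟨x₁, l, rfl, h₄⟩ := List.length_eq_succ_iff.mp (by simpa using hl : l.length = 4 + 1)
    obtain ⟨x₂, x₃, x₄, x₅, rfl⟩ := List.length_eq_four.mp h₄
    simp [elimStep_cons_cons]
  · obtain ⟨x₁, x₂, x₃, x₄, rfl⟩ := List.length_eq_four.mp (by simpa using hl)
    simp [elimStep_cons_cons]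
  · obtain ⟨x₁, x₂, x₃, rfl⟩ := List.length_eq_three.mp (by simpa using hl)
    simp [elimStep_cons_cons]
end
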